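/- arXiv:2509.21154 — 4 statements merged into one kernel-verified Lean document; each statement's English description precedes it below -/
import Mathlib

section
/- (Theorem 1, GRPO = PRM.) Assume N = ∑_{i=1}^k len(g_i) > 0 and r_std > 0. Then the standard GRPO loss with outcome-level advantages equals the PRM loss with step-level advantages: (1/N)·∑_{i=1}^k ∑_{t=0}^{len(g_i)−1} (P_{i,t}·a_i − D_{i,t}) = (1/N)·∑_{i=1}^k ∑_{t=0}^{len(g_i)−1} (P_{i,t}·A_{i,t} − D_{i,t}). -/
/-- `nodeG g p` is the set of indices `i` such that `p` is a prefix of the trajectory `g i`. -/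
noncomputable def nodeG {α : Type*} {k : ℕ} (g : Fin k → List α) (p : List α) :
    Finset (Fin k) :=
  @Finset.filter _ (fun i => p <+: g i) (Classical.decPred _) Finset.univ

/-- `BG g` is the family of process sets: nonempty sets of the form `nodeG g p`. -/
def BG {α : Type*} {k : ℕ} (g : Fin k → List α) : Set (Finset (Fin k)) :=
  {L | ∃ p : List α, (nodeG g p).Nonempty ∧ nodeG g p = L}

/-- `eG g L` is the length of the longest common prefix of the trajectories `g i`, `i ∈ L`. -/
noncomputable def eG {α : Type*} {k : ℕ} (g : Fin k → List α) (L : Finset (Fin k)) : ℕ :=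
  sSup {n : ℕ | ∃ p : List α, p.length = n ∧ ∀ i ∈ L, p <+: g i}

-- The immediate parent of a process set: its least strict superset in `BG g`.
open Classical in
noncomputable def parentG {α : Type*} {k : ℕ} (g : Fin k → List α) (L : Finset (Fin k)) :
    Finset (Fin k) :=
  if h : ∃ M, M ∈ BG g ∧ L ⊂ M ∧ ∀ M' ∈ BG g, L ⊂ M' → M ⊆ M' then h.choose
  else Finset.univ

/-- Start index of the process step of `L`: `0` for the root, `eG g (parentG g L)` otherwise. -/
noncomputable def sG {α : Type*} {k : ℕ} (g : Fin k → List α) (L : Finset (Fin k)) : ℕ :=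
  if L = Finset.univ then 0 else eG g (parentG g L)

/-- `XtG g t` is the family of process sets whose token span contains the index `t`. -/
noncomputable def XtG {α : Type*} {k : ℕ} (g : Fin k → List α) (t : ℕ) :
    Finset (Finset (Fin k)) :=
  @Finset.filter _ (fun L => L ∈ BG g ∧ sG g L ≤ t ∧ t < eG g L)
    (Classical.decPred _) Finset.univ

/-- Mean of the rewards. -/
noncomputable def rmeanG {k : ℕ} (r : Fin k → ℝ) : ℝ := (∑ i, r i) / k

/-- Standard deviation of the rewards. -/
noncomputable def rstdG {k : ℕ} (r : Fin k → ℝ) : ℝ :=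
  Real.sqrt ((∑ i, (r i - rmeanG r) ^ 2) / k)

/-- Outcome-level advantage `a_i`. -/
noncomputable def advG {k : ℕ} (r : Fin k → ℝ) (i : Fin k) : ℝ :=
  (r i - rmeanG r) / rstdG r

/-- Step-level reward `R̂(λ)`. -/
noncomputable def RhatG {k : ℕ} (r : Fin k → ℝ) (L : Finset (Fin k)) : ℝ :=
  (∑ i ∈ L, r i) / L.card

/-- Step-level advantage `Â(λ)`. -/
noncomputable def AhatG {k : ℕ} (r : Fin k → ℝ) (L : Finset (Fin k)) : ℝ :=
  (RhatG r L - rmeanG r) / rstdG r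

open Classical in
/-- The finite set of nonempty prefixes of the trajectories `g i`. -/
noncomputable def prefixesG {α : Type*} {k : ℕ} (g : Fin k → List α) : Finset (List α) :=
  Finset.univ.biUnion fun i =>
    Finset.univ.image fun t : Fin (g i).length => (g i).take ((t : ℕ) + 1)

theorem mem_nodeG {α : Type*} {k : ℕ} {g : Fin k → List α} {p : List α} {i : Fin k} :
    i ∈ nodeG g p ↔ p <+: g i := by
  simp [nodeG]

theorem mem_prefixesG {α : Type*} {k : ℕ} {g : Fin k → List α} {p : List α} :
    p ∈ prefixesG g ↔ ∃ i, ∃ t : Fin (g i).length, (g i).take ((t : ℕ) + 1) = p := by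
  simp [prefixesG]

theorem nodeG_nonempty_of_mem_prefixesG {α : Type*} {k : ℕ} {g : Fin k → List α} {p : List α}
    (hp : p ∈ prefixesG g) : (nodeG g p).Nonempty := by
  obtain ⟨i, t, rfl⟩ := mem_prefixesG.1 hp
  exact ⟨i, mem_nodeG.2 (List.take_prefix _ _)⟩

theorem ne_nil_of_mem_prefixesG {α : Type*} {k : ℕ} {g : Fin k → List α} {p : List α}
    (hp : p ∈ prefixesG g) : p ≠ [] := by
  obtain ⟨i, t, rfl⟩ := mem_prefixesG.1 hp
  have := t.2
  apply List.ne_nil_of_length_pos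
  rw [List.length_take]
  omega

/-- Summing over the positions of all trajectories amounts to summing over the nonempty prefixes
and, for each of them, over the trajectories passing through it. -/
theorem sum_take_eq_sum_nodeG {α : Type*} {k : ℕ} (g : Fin k → List α)
    (φ : Fin k → List α → ℝ) :
    ∑ i, ∑ t : Fin (g i).length, φ i ((g i).take ((t : ℕ) + 1)) =
      ∑ p ∈ prefixesG g, ∑ i ∈ nodeG g p, φ i p := by
  classical
  have hcomm : ∑ p ∈ prefixesG g, ∑ i ∈ nodeG g p, φ i p =
      ∑ i, ∑ p ∈ (prefixesG g).filter (fun p => p <+: g i), φ i p :=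
    Finset.sum_comm' fun p i => by simp [mem_nodeG]
  rw [hcomm]
  refine Finset.sum_congr rfl fun i _ => ?_
  refine Finset.sum_bij (fun t _ => (g i).take ((t : ℕ) + 1)) ?_ ?_ ?_ fun _ _ => rfl
  · exact fun t _ => Finset.mem_filter.2 ⟨mem_prefixesG.2 ⟨i, t, rfl⟩, List.take_prefix _ _⟩
  · intro s _ t _ hst
    have hlen := congrArg List.length hst
    have hs := s.2
    have ht := t.2
    rw [List.length_take, List.length_take] at hlen
    ext
    omega
  · intro p hp
    obtain ⟨hmem, hpre⟩ := Finset.mem_filter.1 hp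
    have hpos := List.length_pos_of_ne_nil (ne_nil_of_mem_prefixesG hmem)
    have hle := hpre.length_le
    refine ⟨⟨p.length - 1, by omega⟩, Finset.mem_univ _, ?_⟩
    simp only [Nat.sub_add_cancel hpos]
    exact (List.prefix_iff_eq_take.1 hpre).symm

theorem sum_advG_eq_sum_AhatG {k : ℕ} (r : Fin k → ℝ) {L : Finset (Fin k)} (hL : L.Nonempty) :
    ∑ i ∈ L, advG r i = ∑ _i ∈ L, AhatG r L := by
  have hcard : (L.card : ℝ) ≠ 0 := by exact_mod_cast hL.card_ne_zero
  simp only [advG, AhatG, RhatG, ← Finset.sum_div, Finset.sum_sub_distrib, Finset.sum_const,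
    nsmul_eq_mul]
  rw [mul_div_cancel_left₀ _ hcard]

/-- Outcome-level and step-level advantages agree under any weighting of the prefixes. -/
theorem sum_mul_advG_eq_sum_mul_AhatG {α : Type*} {k : ℕ} (g : Fin k → List α)
    (r : Fin k → ℝ) (w : List α → ℝ) :
    ∑ i, ∑ t : Fin (g i).length, w ((g i).take ((t : ℕ) + 1)) * advG r i =
      ∑ i, ∑ t : Fin (g i).length,
        w ((g i).take ((t : ℕ) + 1)) * AhatG r (nodeG g ((g i).take ((t : ℕ) + 1))) := by
  rw [sum_take_eq_sum_nodeG g fun i p => w p * advG r i,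
    sum_take_eq_sum_nodeG g fun _ p => w p * AhatG r (nodeG g p)]
  refine Finset.sum_congr rfl fun p hp => ?_
  rw [← Finset.mul_sum, ← Finset.mul_sum,
    sum_advG_eq_sum_AhatG r (nodeG_nonempty_of_mem_prefixesG hp)]

/-- A function of a context and its next token, as a function of the extended sequence. -/
theorem exists_eq_take_succ {α : Type*} (f : List α → α → ℝ) :
    ∃ w : List α → ℝ, ∀ (l : List α) (t : Fin l.length),
      f (l.take (t : ℕ)) (l.get t) = w (l.take ((t : ℕ) + 1)) := by
  classical
  let w : List α → ℝ := fun p => if h : p ≠ [] then f p.dropLast (p.getLast h) else 0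
  have hw : ∀ p x, w (p ++ [x]) = f p x := fun p x => by simp [w]
  refine ⟨w, fun l t => ?_⟩
  rw [← hw]
  congr 1
  simp

/-- **Theorem 1 (GRPO = PRM).** Under `N = ∑ len(gᵢ) > 0` and `r_std > 0`, the standard GRPO
loss with outcome-level advantages equals the PRM loss with step-level advantages. -/
theorem grpo_loss_eq_prm_loss {α : Type*} {k : ℕ} (hk : 1 ≤ k)
    (g : Fin k → List α) (r : Fin k → ℝ) (hstd : 0 < rstdG r)
    (πθ πold πref : List α → α → ℝ)
    (hπθ : ∀ p x, 0 < πθ p x) (hπold : ∀ p x, 0 < πold p x) (hπref : ∀ p x, 0 < πref p x)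
    (hN : 0 < ∑ i, (g i).length) :
    (1 / ((∑ i, (g i).length : ℕ) : ℝ)) *
        ∑ i, ∑ t : Fin (g i).length,
          (πθ ((g i).take (t : ℕ)) ((g i).get t) / πold ((g i).take (t : ℕ)) ((g i).get t)
              * advG r i -
            (πref ((g i).take (t : ℕ)) ((g i).get t) / πθ ((g i).take (t : ℕ)) ((g i).get t) -
              Real.log (πref ((g i).take (t : ℕ)) ((g i).get t) /
                πθ ((g i).take (t : ℕ)) ((g i).get t)) - 1)) =
      (1 / ((∑ i, (g i).length : ℕ) : ℝ)) *
        ∑ i, ∑ t : Fin (g i).length,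
          (πθ ((g i).take (t : ℕ)) ((g i).get t) / πold ((g i).take (t : ℕ)) ((g i).get t)
              * AhatG r (nodeG g ((g i).take ((t : ℕ) + 1))) -
            (πref ((g i).take (t : ℕ)) ((g i).get t) / πθ ((g i).take (t : ℕ)) ((g i).get t) -
              Real.log (πref ((g i).take (t : ℕ)) ((g i).get t) /
                πθ ((g i).take (t : ℕ)) ((g i).get t)) - 1)) := by
  obtain ⟨w, hw⟩ := exists_eq_take_succ fun p x => πθ p x / πold p x
  congr 1
  simp only [Finset.sum_sub_distrib, hw]
  rw [sum_mul_advG_eq_sum_mul_AhatG]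
end

section
/- (Existence, uniqueness, and closed form of the process set containing a given token.) For every index i and every 0 ≤ t < len(g_i): λ^{(i,t)} = node(g_i.take(t+1)) is a process set in B(G) containing i with s(λ^{(i,t)}) ≤ t < e(λ^{(i,t)}); moreover, for every λ ∈ B(G) with i ∈ λ, one has s(λ) ≤ t < e(λ) if and only if λ = λ^{(i,t)}. In particular λ^{(i,t)} is the unique process set containing i whose token span contains t. -/
/-- Two process sets with a common element are comparable. -/
theorem BG_subset_or_subset {α : Type*} {k : ℕ} {g : Fin k → List α} {L M : Finset (Fin k)}
    {i : Fin k} (hL : L ∈ BG g) (hM : M ∈ BG g) (hiL : i ∈ L) (hiM : i ∈ M) :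
    L ⊆ M ∨ M ⊆ L := by
  obtain ⟨p, -, rfl⟩ := hL
  obtain ⟨q, -, rfl⟩ := hM
  rcases List.prefix_or_prefix_of_prefix (mem_nodeG.1 hiL) (mem_nodeG.1 hiM) with h | h
  · exact .inr fun j hj => mem_nodeG.2 (h.trans (mem_nodeG.1 hj))
  · exact .inl fun j hj => mem_nodeG.2 (h.trans (mem_nodeG.1 hj))

theorem mem_nodeG_take {α : Type*} {k : ℕ} (g : Fin k → List α) (i : Fin k) (n : ℕ) :
    i ∈ nodeG g ((g i).take n) :=
  mem_nodeG.2 (List.take_prefix _ _)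

theorem nodeG_take_mem_BG {α : Type*} {k : ℕ} (g : Fin k → List α) (i : Fin k) (n : ℕ) :
    nodeG g ((g i).take n) ∈ BG g :=
  ⟨_, ⟨i, mem_nodeG_take g i n⟩, rfl⟩

theorem univ_mem_BG {α : Type*} {k : ℕ} (g : Fin k → List α) (i : Fin k) :
    Finset.univ ∈ BG g := by
  have h : nodeG g [] = Finset.univ := by ext; simp [mem_nodeG]
  exact ⟨[], by rw [h]; exact ⟨i, Finset.mem_univ i⟩, h⟩

theorem le_eG_iff {α : Type*} {k : ℕ} {g : Fin k → List α} {L : Finset (Fin k)} {i : Fin k}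
    {n : ℕ} (hi : i ∈ L) (hn : n ≤ (g i).length) :
    n ≤ eG g L ↔ L ⊆ nodeG g ((g i).take n) := by
  have hbdd : BddAbove {n : ℕ | ∃ p : List α, p.length = n ∧ ∀ i ∈ L, p <+: g i} := by
    refine ⟨(g i).length, ?_⟩
    rintro _ ⟨p, rfl, hp⟩
    exact (hp i hi).length_le
  have hne : {n : ℕ | ∃ p : List α, p.length = n ∧ ∀ i ∈ L, p <+: g i}.Nonempty :=
    ⟨0, [], rfl, fun _ _ => List.nil_prefix⟩
  constructor
  · intro h j hj
    obtain ⟨p, hp, hpL⟩ := Nat.sSup_mem hne hbdd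
    have hnp : n ≤ p.length := h.trans hp.ge
    refine mem_nodeG.2 (.trans ?_ (hpL j hj))
    exact List.prefix_of_prefix_length_le (List.take_prefix _ _) (hpL i hi)
      ((List.length_take_le _ _).trans hnp)
  · intro h
    exact le_csSup hbdd ⟨(g i).take n, by simpa using hn, fun j hj => mem_nodeG.1 (h hj)⟩

/-- The parent of a non-root process set is its least strict superset in `BG g`. -/
theorem parentG_spec {α : Type*} {k : ℕ} {g : Fin k → List α} {L : Finset (Fin k)} {i : Fin k}
    (hi : i ∈ L) (hne : L ≠ Finset.univ) :
    parentG g L ∈ BG g ∧ L ⊂ parentG g L ∧ ∀ M ∈ BG g, L ⊂ M → parentG g L ⊆ M := by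
  have hex : ∃ M, M ∈ BG g ∧ L ⊂ M ∧ ∀ M' ∈ BG g, L ⊂ M' → M ⊆ M' := by
    obtain ⟨M, hM⟩ := (Set.toFinite {M | M ∈ BG g ∧ L ⊂ M}).exists_minimal
      ⟨Finset.univ, univ_mem_BG g i, Finset.ssubset_univ_iff.2 hne⟩
    refine ⟨M, hM.prop.1, hM.prop.2, fun M' hM' hLM' => ?_⟩
    rcases BG_subset_or_subset hM.prop.1 hM' (hM.prop.2.subset hi) (hLM'.subset hi) with h | h
    · exact h
    · exact hM.le_of_le ⟨hM', hLM'⟩ h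
  rw [parentG, dif_pos hex]
  exact hex.choose_spec

theorem sG_le_iff {α : Type*} {k : ℕ} {g : Fin k → List α} {L : Finset (Fin k)} {i : Fin k}
    {t : ℕ} (hL : L ∈ BG g) (hi : i ∈ L) (ht : t < (g i).length) :
    sG g L ≤ t ↔ nodeG g ((g i).take (t + 1)) ⊆ L := by
  by_cases hne : L = Finset.univ
  · simp [sG, hne]
  obtain ⟨-, hLP, hmin⟩ := parentG_spec (g := g) hi hne
  rw [sG, if_neg hne, ← not_lt, ← Nat.succ_le_iff, Nat.succ_eq_add_one,
    le_eG_iff (hLP.subset hi) ht]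
  constructor
  · intro h
    by_contra hN
    have hLN := (BG_subset_or_subset (nodeG_take_mem_BG g i (t + 1)) hL
      (mem_nodeG_take g i _) hi).resolve_left hN
    exact h (hmin _ (nodeG_take_mem_BG g i _) ⟨hLN, hN⟩)
  · exact fun hN hP => hLP.not_subset (hP.trans hN)

/-- **Existence, uniqueness, and closed form of the process set containing a given token.**
For `t < len(gᵢ)`: `λ^{(i,t)} = node (gᵢ.take (t+1))` is a process set containing `i` with
`s(λ^{(i,t)}) ≤ t < e(λ^{(i,t)})`, and for every `λ ∈ B(G)` containing `i`,
`s(λ) ≤ t < e(λ)` iff `λ = λ^{(i,t)}`. -/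
theorem process_set_of_token_exists_unique {α : Type*} {k : ℕ} (hk : 1 ≤ k)
    (g : Fin k → List α) (i : Fin k) (t : ℕ) (ht : t < (g i).length) :
    nodeG g ((g i).take (t + 1)) ∈ BG g ∧
      i ∈ nodeG g ((g i).take (t + 1)) ∧
      sG g (nodeG g ((g i).take (t + 1))) ≤ t ∧
      t < eG g (nodeG g ((g i).take (t + 1))) ∧
      ∀ L ∈ BG g, i ∈ L →
        ((sG g L ≤ t ∧ t < eG g L) ↔ L = nodeG g ((g i).take (t + 1))) := by
  have key : ∀ L ∈ BG g, i ∈ L →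
      ((sG g L ≤ t ∧ t < eG g L) ↔ L = nodeG g ((g i).take (t + 1))) := by
    intro L hL hi
    rw [sG_le_iff hL hi ht, ← Nat.succ_le_iff, Nat.succ_eq_add_one, le_eG_iff hi ht, and_comm]
    exact Finset.Subset.antisymm_iff.symm
  have hB := nodeG_take_mem_BG g i (t + 1)
  have hi := mem_nodeG_take g i (t + 1)
  have hspan := (key _ hB hi).2 rfl
  exact ⟨hB, hi, hspan.1, hspan.2, key⟩
end

section
/- (Strict antitonicity of the common-prefix length e.) For all λ, μ ∈ B(G): if λ ⊆ μ then e(μ) ≤ e(λ), and if λ ⊊ μ then e(μ) < e(λ). -/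
theorem length_le_eG {α : Type*} {k : ℕ} {g : Fin k → List α} {L : Finset (Fin k)}
    (hL : L.Nonempty) {p : List α} (hp : ∀ i ∈ L, p <+: g i) : p.length ≤ eG g L := by
  obtain ⟨i, hi⟩ := hL
  refine le_csSup ⟨(g i).length, ?_⟩ ⟨p, rfl, hp⟩
  rintro _ ⟨q, rfl, hq⟩
  exact (hq i hi).length_le

theorem exists_length_eq_eG {α : Type*} {k : ℕ} (g : Fin k → List α) {L : Finset (Fin k)}
    (hL : L.Nonempty) : ∃ p : List α, p.length = eG g L ∧ ∀ i ∈ L, p <+: g i := by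
  obtain ⟨i, hi⟩ := hL
  refine Nat.sSup_mem (s := {n : ℕ | ∃ p : List α, p.length = n ∧ ∀ i ∈ L, p <+: g i})
    ⟨0, [], rfl, fun _ _ => List.nil_prefix⟩ ⟨(g i).length, ?_⟩
  rintro _ ⟨q, rfl, hq⟩
  exact (hq i hi).length_le

/-- On a nonempty set the common-prefix length is antitone. -/
theorem eG_anti {α : Type*} {k : ℕ} (g : Fin k → List α) {L M : Finset (Fin k)}
    (hL : L.Nonempty) (hLM : L ⊆ M) : eG g M ≤ eG g L := by
  obtain ⟨p, hp, hpM⟩ := exists_length_eq_eG g (hL.mono hLM)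
  exact hp ▸ length_le_eG hL fun i hi => hpM i (hLM hi)

/-- A process set is determined by any common prefix of maximal length. -/
theorem nodeG_subset_of_length_eq_eG {α : Type*} {k : ℕ} {g : Fin k → List α}
    {L : Finset (Fin k)} (hL : L ∈ BG g) {p : List α} (hp : ∀ i ∈ L, p <+: g i)
    (hlen : p.length = eG g L) : nodeG g p ⊆ L := by
  obtain ⟨q, hne, rfl⟩ := hL
  obtain ⟨i, hi⟩ := hne
  have hqp : q <+: p :=
    List.prefix_of_prefix_length_le (mem_nodeG.1 hi) (hp i hi)
      (hlen ▸ length_le_eG ⟨i, hi⟩ fun _ => mem_nodeG.1)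
  exact fun j hj => mem_nodeG.2 (hqp.trans (mem_nodeG.1 hj))

/-- **Strict antitonicity of the common-prefix length `e`.** For all `λ, μ ∈ B(G)`:
if `λ ⊆ μ` then `e(μ) ≤ e(λ)`, and if `λ ⊊ μ` then `e(μ) < e(λ)`. -/
theorem eG_strict_antitone {α : Type*} {k : ℕ} (hk : 1 ≤ k) (g : Fin k → List α) :
    ∀ L ∈ BG g, ∀ M ∈ BG g, (L ⊆ M → eG g M ≤ eG g L) ∧ (L ⊂ M → eG g M < eG g L) := by
  intro L hL M hM
  have hne : L.Nonempty := by
    obtain ⟨q, hq, rfl⟩ := hL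
    exact hq
  refine ⟨eG_anti g hne, fun hLM => (eG_anti g hne hLM.subset).lt_of_ne fun heq => ?_⟩
  obtain ⟨p, hp, hpM⟩ := exists_length_eq_eG g (hne.mono hLM.subset)
  have hML : M ⊆ L := fun j hj =>
    nodeG_subset_of_length_eq_eG hL (fun i hi => hpM i (hLM.subset hi)) (hp.trans heq)
      (mem_nodeG.2 (hpM j hj))
  exact hLM.not_subset hML
end

section
/- (Trivial B(G) reduces the induced PRM to an outcome reward model.) Suppose that no two trajectories with distinct indices share the same first token (i.e., for all i ≠ j with g_i and g_j nonempty, their first tokens differ). Then for every index i and every 0 ≤ t < len(g_i): λ^{(i,t)} = {i}, and consequently A_{i,t} = a_i; i.e., every token's step-level advantage equals the trajectory's outcome-level advantage. -/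
theorem AhatG_singleton {k : ℕ} (r : Fin k → ℝ) (i : Fin k) : AhatG r {i} = advG r i := by
  simp [AhatG, RhatG, advG]

/-- If first tokens separate trajectories, a nonempty prefix determines its trajectory. -/
theorem nodeG_take_eq_singleton {α : Type*} {k : ℕ} {g : Fin k → List α}
    (h : ∀ i j : Fin k, i ≠ j → g i ≠ [] → g j ≠ [] → (g i).head? ≠ (g j).head?)
    {i : Fin k} (hi : g i ≠ []) (t : ℕ) : nodeG g ((g i).take (t + 1)) = {i} := by
  ext j
  rw [mem_nodeG, Finset.mem_singleton]
  constructor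
  · rintro ⟨s, hs⟩
    by_contra hji
    obtain ⟨a, l, hl⟩ := List.exists_cons_of_ne_nil hi
    have hj : g j = a :: (l.take t ++ s) := by simpa [hl] using hs.symm
    exact h i j (Ne.symm hji) hi (by simp [hj]) (by simp [hl, hj])
  · rintro rfl
    exact List.take_prefix _ _

/-- **Trivial `B(G)` reduces the induced PRM to an outcome reward model.** If no two
trajectories with distinct indices share the same first token, then for every `i` and every
`t < len(gᵢ)`: `λ^{(i,t)} = {i}` and hence `A_{i,t} = a_i`. -/
theorem trivial_BG_reduces_to_orm {α : Type*} {k : ℕ} (hk : 1 ≤ k)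
    (g : Fin k → List α) (r : Fin k → ℝ) (hstd : 0 < rstdG r)
    (h : ∀ i j : Fin k, i ≠ j → g i ≠ [] → g j ≠ [] → (g i).head? ≠ (g j).head?) :
    ∀ i : Fin k, ∀ t : ℕ, t < (g i).length →
      nodeG g ((g i).take (t + 1)) = ({i} : Finset (Fin k)) ∧
        AhatG r (nodeG g ((g i).take (t + 1))) = advG r i := by
  intro i t ht
  have hnode := nodeG_take_eq_singleton h (List.ne_nil_of_length_pos (Nat.zero_lt_of_lt ht)) t
  exact ⟨hnode, by rw [hnode, AhatG_singleton]⟩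
end
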